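/- Fix σ ∈ S_3. Suppose t_n ∈ 𝔗_f for each n, t ∈ 𝔗_∞, and t_n → t in the local topology. Then for each k ∈ ℕ, Φ_{t_n}^σ(k) → Φ_t^σ(k) in ℕ* = ℕ ∪ {∞} (the one-point compactification of ℕ). -/

import Mathlib

open Set Filter MeasureTheory Topology TopologicalSpace
open scoped ENNReal

namespace AvoidPaper

/-- Instances for the codomain `ℕ∞` (one-point compactification of `ℕ`). -/
instance : SecondCountableTopology ℕ∞ := by
  have h : ({s : Set ℕ∞ | ∃ a, s = Set.Ioi a ∨ s = Set.Iio a}).Countable := by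
    have hsub : {s : Set ℕ∞ | ∃ a, s = Set.Ioi a ∨ s = Set.Iio a}
        ⊆ Set.range (Set.Ioi : ℕ∞ → Set ℕ∞) ∪ Set.range (Set.Iio : ℕ∞ → Set ℕ∞) := by
      rintro s ⟨a, rfl | rfl⟩
      · exact Or.inl ⟨a, rfl⟩
      · exact Or.inr ⟨a, rfl⟩
    exact ((Set.countable_range _).union (Set.countable_range _)).mono hsub
  exact SecondCountableTopology.mk' h

instance : OpensMeasurableSpace ℕ∞ := ⟨le_top⟩

/-! ## Ulam–Harris vertices and rooted ordered trees -/

/-- A vertex of the Ulam–Harris tree: a finite list of natural numbers (children indices),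
ordered lexicographically (so an ancestor precedes its descendants). -/
abbrev Vertex : Type := List ℕ

/-- A (rooted ordered) tree: contains the root, is closed under ancestors, and is
left-closed among siblings. -/
def IsTree (t : Set Vertex) : Prop :=
  ([] : Vertex) ∈ t ∧ (∀ u v : Vertex, u ++ v ∈ t → u ∈ t) ∧
    ∀ (u : Vertex) (i j : ℕ), u ++ [i] ∈ t → j ≤ i → u ++ [j] ∈ t

/-- The set of children indices of `u` in `t`. -/
def children (t : Set Vertex) (u : Vertex) : Set ℕ := {i | u ++ [i] ∈ t}

/-- Locally finite tree. -/
def LocFin (t : Set Vertex) : Prop := ∀ u : Vertex, (children t u).Finite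

/-- Number of children of `u` in `t`. -/
noncomputable def childCount (t : Set Vertex) (u : Vertex) : ℕ := (children t u).ncard

/-- The degree function `d_t(u)`: number of children, and `-1` if `u ∉ t`. -/
noncomputable def deg (t : Set Vertex) (u : Vertex) : ℤ :=
  haveI := Classical.dec (u ∈ t)
  if u ∈ t then (childCount t u : ℤ) else -1

/-- `t^[m]`: restriction of `t` to the vertices of height at most `m`. -/
def trunc (t : Set Vertex) (m : ℕ) : Set Vertex := {u ∈ t | u.length ≤ m}

/-- Local convergence of trees: `d_{t_n}(u) → d_t(u)` for every vertex `u`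
(equivalently, eventual equality, since degrees are integers). -/
def LocalConv (ts : ℕ → Set Vertex) (t : Set Vertex) : Prop :=
  ∀ u : Vertex, ∀ᶠ n in atTop, deg (ts n) u = deg t u

/-- A leaf: a vertex of `t` with no children. -/
def IsLeaf (t : Set Vertex) (v : Vertex) : Prop := v ∈ t ∧ ∀ i : ℕ, v ++ [i] ∉ t

def leafSet (t : Set Vertex) : Set Vertex := {v | IsLeaf t v}

/-- The fringe subtree `t_v` of `t` at `v` (as a subset of `t`). -/
def fringe (t : Set Vertex) (v : Vertex) : Set Vertex := {x ∈ t | v <+: x}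

/-- Number of vertices of `t` at height exactly `k`. -/
noncomputable def levelCount (t : Set Vertex) (k : ℕ) : ℕ := {u ∈ t | u.length = k}.ncard

/-- An infinite spine of `t`: `η 0` is the root and `η (i+1)` is a child of `η i`. -/
def IsSpine (t : Set Vertex) (η : ℕ → Vertex) : Prop :=
  η 0 = [] ∧ (∀ i, η i ∈ t) ∧ ∀ i, ∃ c : ℕ, η (i + 1) = η i ++ [c]

/-- `v` lies strictly to the left of the spine `η`. -/
def LeftOfSpine (t : Set Vertex) (η : ℕ → Vertex) (v : Vertex) : Prop :=
  v ∈ t ∧ (∀ i, η i ≠ v) ∧ ∃ j, v < η j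

/-- `v` lies strictly to the right of the spine `η`. -/
def RightOfSpine (t : Set Vertex) (η : ℕ → Vertex) (v : Vertex) : Prop :=
  v ∈ t ∧ ∀ j, η j < v

/-- `η` is the unique infinite spine of `t`, with infinitely many subtrees attached to
the left and to the right of the spine, infinitely many of the left ones having at
least two vertices. -/
def SpineSpec (t : Set Vertex) (η : ℕ → Vertex) : Prop :=
  IsSpine t η ∧ (∀ η', IsSpine t η' → η' = η) ∧
  {u : Vertex | (∃ k c, u = η k ++ [c]) ∧ LeftOfSpine t η u}.Infinite ∧
  {u : Vertex | (∃ k c, u = η k ++ [c]) ∧ RightOfSpine t η u}.Infinite ∧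
  {u : Vertex | (∃ k c, u = η k ++ [c]) ∧ LeftOfSpine t η u ∧
      2 ≤ (fringe t u).encard}.Infinite

/-- `𝔗_f`: finite trees with at least two vertices. -/
def MemTf (t : Set Vertex) : Prop := IsTree t ∧ t.Finite ∧ 2 ≤ t.encard

/-- `𝔗_∞`. -/
def MemTinf (t : Set Vertex) : Prop :=
  IsTree t ∧ LocFin t ∧ t.Infinite ∧ ∃ η : ℕ → Vertex, SpineSpec t η

/-- The leaves of `t` lying to the left of the spine `η`. -/
def leftLeaves (t : Set Vertex) (η : ℕ → Vertex) : Set Vertex :=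
  {x | IsLeaf t x ∧ LeftOfSpine t η x}

/-- `v` is the enumeration `(v_{t,i})` of (an initial part of) `t` in increasing
lexicographic order: `v i ∈ t` and the vertices of `t` smaller than `v i` are
exactly `v 0, …, v (i-1)`. -/
def IsLexEnum (t : Set Vertex) (v : ℕ → Vertex) : Prop :=
  ∀ i : ℕ, (i : ℕ∞) < t.encard →
    v i ∈ t ∧ {x ∈ t | x < v i} = v '' {j | j < i}

/-- `w` is the enumeration `(w_{t,i})` of (a final part of) `t` in decreasing
lexicographic order, starting from the lexicographically largest vertex. -/
def IsLexCoEnum (t : Set Vertex) (w : ℕ → Vertex) : Prop :=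
  ∀ i : ℕ, (i : ℕ∞) < t.encard →
    w i ∈ t ∧ {x ∈ t | w i < x} = w '' {j | j < i}

/-- `l` enumerates the set `A` in increasing lexicographic order. -/
def IsEnumOf (A : Set Vertex) (l : ℕ → Vertex) : Prop :=
  ∀ i : ℕ, (i : ℕ∞) < A.encard →
    l i ∈ A ∧ {x ∈ A | x < l i} = l '' {j | j < i}

/-- `s_i`: the number of vertices of `t` lexicographically smaller than the `i`-th leaf
(0-indexed: `l 0` is the paper's `l_1`). -/
noncomputable def sVal (t : Set Vertex) (l : ℕ → Vertex) (i : ℕ) : ℕ :=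
  {x ∈ t | x < l i}.ncard

/-- `p_i`: the height of the `i`-th leaf. -/
def pVal (l : ℕ → Vertex) (i : ℕ) : ℕ := (l i).length

/-! ## The maps Φ^σ -/

/-- `Φ^{231}` as an element of `F(ℕ, ℕ*)` (value `i` outside the range of indices). -/
noncomputable def phi231 (t : Set Vertex) (v : ℕ → Vertex) : ℕ → ℕ∞ := fun i =>
  if 1 ≤ i ∧ (i : ℕ∞) < t.encard then
    ((i : ℕ∞) + (fringe t (v i)).encard) - ((v i).length : ℕ∞)
  else (i : ℕ∞)

noncomputable def phi213 (t : Set Vertex) (v : ℕ → Vertex) : ℕ → ℕ∞ := fun i =>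
  if 1 ≤ i ∧ (i : ℕ∞) < t.encard then
    ((t \ fringe t (v i)).encard + ((v i).length : ℕ∞)) - (i : ℕ∞)
  else (i : ℕ∞)

noncomputable def phi312 (t : Set Vertex) (w : ℕ → Vertex) : ℕ → ℕ∞ := fun i =>
  if 1 ≤ i ∧ (i : ℕ∞) < t.encard then
    ((i : ℕ∞) + ((w (i - 1)).length : ℕ∞)) - (fringe t (w (i - 1))).encard
  else (i : ℕ∞)

noncomputable def phi132 (t : Set Vertex) (w : ℕ → Vertex) : ℕ → ℕ∞ := fun i =>
  if 1 ≤ i ∧ (i : ℕ∞) < t.encard then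
    ((t.encard + (fringe t (w (i - 1))).encard) - (i : ℕ∞)) - ((w (i - 1)).length : ℕ∞)
  else (i : ℕ∞)

/-- `B = {s_i - p_i + 1 : i}` (with `i` ranging over indices `< L` of leaves). -/
def Bset (S P : ℕ → ℕ) (L : ℕ∞) : Set ℕ :=
  {b | ∃ i : ℕ, (i : ℕ∞) < L ∧ S i - P i + 1 = b}

/-- `A = {s_i : i}`. -/
def Aset (S : ℕ → ℕ) (L : ℕ∞) : Set ℕ := {a | ∃ i : ℕ, (i : ℕ∞) < L ∧ S i = a}

/-- The number of elements of `C` in `{1, …, j}`. -/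
noncomputable def rankIn (C : Set ℕ) (j : ℕ) : ℕ := (C ∩ Set.Icc 1 j).ncard

/-- The `a`-th smallest positive element of `C`. -/
noncomputable def nthOf (C : Set ℕ) (a : ℕ) : ℕ :=
  sInf {m : ℕ | a ≤ (C ∩ Set.Icc 1 m).ncard}

open Classical in
/-- `Φ^{321}` built from the data `s, p` (and the number `L` of leaves):
`s_i - p_i + 1 ↦ s_i`, extended by the unique increasing bijection between the
complements (and by the identity outside `[1, n]` in the finite case). -/
noncomputable def phi321Fun (S P : ℕ → ℕ) (L : ℕ∞) : ℕ → ℕ∞ := fun j =>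
  if h : j ∈ Bset S P L then (S h.choose : ℕ∞)
  else (nthOf (Aset S L)ᶜ (rankIn (Bset S P L)ᶜ j) : ℕ∞)

/-- `Φ^{123} = |t| + 1 - Φ^{321}` as an element of `F(ℕ, ℕ*)`. -/
noncomputable def phi123Fun (tc : ℕ∞) (f : ℕ → ℕ∞) : ℕ → ℕ∞ := fun j =>
  if 1 ≤ j ∧ (j : ℕ∞) < tc then (tc + 1) - f j else (j : ℕ∞)

/-! ## Patterns and pattern avoidance -/

def p123 : Equiv.Perm (Fin 3) := Equiv.refl _
noncomputable def p321 : Equiv.Perm (Fin 3) := Equiv.ofBijective ![2, 1, 0] (by decide)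
noncomputable def p231 : Equiv.Perm (Fin 3) := Equiv.ofBijective ![1, 2, 0] (by decide)
noncomputable def p213 : Equiv.Perm (Fin 3) := Equiv.ofBijective ![1, 0, 2] (by decide)
noncomputable def p312 : Equiv.Perm (Fin 3) := Equiv.ofBijective ![2, 0, 1] (by decide)
noncomputable def p132 : Equiv.Perm (Fin 3) := Equiv.ofBijective ![0, 2, 1] (by decide)

/-- `π` contains the length-3 pattern `σ`. -/
def ContainsPat {n : ℕ} (π : Equiv.Perm (Fin n)) (σ : Equiv.Perm (Fin 3)) : Prop :=
  ∃ f : Fin 3 → Fin n, StrictMono f ∧ ∀ j k : Fin 3, σ j < σ k ↔ π (f j) < π (f k)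

/-- `π` avoids the length-3 pattern `σ`. -/
def AvoidsPat {n : ℕ} (π : Equiv.Perm (Fin n)) (σ : Equiv.Perm (Fin 3)) : Prop :=
  ¬ ContainsPat π σ

/-- Trees with `n+1` vertices. -/
def TreeN (n : ℕ) : Type := {t : Set Vertex // IsTree t ∧ t.encard = (n : ℕ∞) + 1}

/-- Embedding of a permutation of `[n]` into `F(ℕ, ℕ*)` by `π(k) = k` for `k > n`
(permutations are `1`-indexed: position `k ∈ [1, n]` corresponds to `k - 1 : Fin n`). -/
noncomputable def embedPerm {n : ℕ} (π : Equiv.Perm (Fin n)) : ℕ → ℕ∞ := fun k =>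
  if h : 1 ≤ k ∧ k ≤ n then (((π ⟨k - 1, by omega⟩ : Fin n) : ℕ) + 1 : ℕ) else (k : ℕ∞)

/-- The (finite) set of permutations of `[n]` avoiding `σ`. -/
noncomputable def avoidFinset (σ : Equiv.Perm (Fin 3)) (n : ℕ) : Finset (Equiv.Perm (Fin n)) :=
  Set.Finite.toFinset (Set.toFinite {π : Equiv.Perm (Fin n) | AvoidsPat π σ})

/-- The law of a uniformly random `σ`-avoiding permutation of `[n]`,
as a measure on `F(ℕ, ℕ*)`. -/
noncomputable def uniformAvoidLaw (σ : Equiv.Perm (Fin 3)) (n : ℕ) : Measure (ℕ → ℕ∞) :=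
  ((avoidFinset σ n).card : ℝ≥0∞)⁻¹ • ∑ π ∈ avoidFinset σ n, Measure.dirac (embedPerm π)


open Classical in
/-- `Φ^σ` for an arbitrary pattern `σ ∈ S_3`, given a tree together with its increasing
vertex enumeration `v`, its decreasing vertex enumeration `w`, and the increasing
enumeration `l` of the relevant set `Lset` of leaves. -/
noncomputable def PhiOf (σ : Equiv.Perm (Fin 3)) (t : Set Vertex)
    (v w l : ℕ → Vertex) (Lset : Set Vertex) : ℕ → ℕ∞ :=
  if σ = p231 then phi231 t v
  else if σ = p213 then phi213 t v
  else if σ = p312 then phi312 t w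
  else if σ = p132 then phi132 t w
  else if σ = p321 then phi321Fun (sVal t l) (pVal l) Lset.encard
  else phi123Fun t.encard (phi321Fun (sVal t l) (pVal l) Lset.encard)

open Classical in
noncomputable def canonSpine (t : Set Vertex) : ℕ → Vertex :=
  if h : ∃ η : ℕ → Vertex, IsSpine t η then h.choose else fun _ => []

open Classical in
noncomputable def canonV (t : Set Vertex) : ℕ → Vertex :=
  if h : ∃ v : ℕ → Vertex, IsLexEnum t v then h.choose else fun _ => []

open Classical in
noncomputable def canonW (t : Set Vertex) : ℕ → Vertex :=
  if h : ∃ w : ℕ → Vertex, IsLexCoEnum t w then h.choose else fun _ => []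

open Classical in
noncomputable def canonL (t : Set Vertex) : ℕ → Vertex :=
  if h : ∃ l : ℕ → Vertex, IsEnumOf (leftLeaves t (canonSpine t)) l then h.choose
  else fun _ => []

/-- `Φ^σ_t` for an infinite tree `t ∈ 𝔗_∞`, using the canonical (unique) spine and
enumerations. -/
noncomputable def PhiCanon (σ : Equiv.Perm (Fin 3)) (t : Set Vertex) : ℕ → ℕ∞ :=
  PhiOf σ t (canonV t) (canonW t) (canonL t) (leftLeaves t (canonSpine t))

/-- σ-algebra on the space of trees: all sets are measurable. -/
instance : MeasurableSpace (Set Vertex) := ⊤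

/-- `μ` is the law of a Galton–Watson tree with offspring distribution `ξ`:
a probability measure, supported on trees, giving each finite tree `t` the
probability `∏_{u ∈ t} ξ(d_t(u))`. -/
def IsGW (ξ : ℕ → ℝ≥0∞) (μ : Measure (Set Vertex)) : Prop :=
  IsProbabilityMeasure μ ∧ μ {t | IsTree t} = 1 ∧
    ∀ t : Set Vertex, IsTree t → ∀ ht : t.Finite,
      μ {t} = ∏ u ∈ ht.toFinset, ξ (childCount t u)

/-- `π` is the permutation `Φ^{321}_t` of `[n]` associated to a finite tree `t` with
`n+1` vertices: for every leaf `v` with `s = #{x ∈ t : x < v}` and `p = |v|`, position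
`s - p + 1` is mapped to `s` (in 0-indexed form: position `s - p` to value `s - 1`),
and `π` is increasing on the remaining positions. -/
def Is321Image (n : ℕ) (t : Set Vertex) (π : Equiv.Perm (Fin n)) : Prop :=
  (∀ v : Vertex, IsLeaf t v →
    ∃ hb : {x ∈ t | x < v}.ncard - v.length < n,
      ((π ⟨{x ∈ t | x < v}.ncard - v.length, hb⟩ : Fin n) : ℕ)
        = {x ∈ t | x < v}.ncard - 1) ∧
  ∀ a b : Fin n, a < b →
    (∀ v : Vertex, IsLeaf t v → {x ∈ t | x < v}.ncard - v.length ≠ (a : ℕ)) →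
    (∀ v : Vertex, IsLeaf t v → {x ∈ t | x < v}.ncard - v.length ≠ (b : ℕ)) →
    π a < π b

/-- `π` is the permutation `Φ^{123}_t = (n+1) - Φ^{321}_t` of `[n]`. -/
def Is123Image (n : ℕ) (t : Set Vertex) (π : Equiv.Perm (Fin n)) : Prop :=
  ∃ π' : Equiv.Perm (Fin n), Is321Image n t π' ∧ ∀ i : Fin n, π i = Fin.rev (π' i)


/-! ### Prefixes and the lexicographic order -/

lemma le_of_isPrefix {a b : Vertex} (h : a <+: b) : a ≤ b := by
  obtain ⟨c, rfl⟩ := h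
  induction a with
  | nil => exact not_lt.1 (List.not_lt_nil _)
  | cons x a ih =>
    refine not_lt.1 fun h => ?_
    rw [List.cons_append, List.cons_lt_cons_iff] at h
    rcases h with h | ⟨-, h⟩
    · exact lt_irrefl _ h
    · exact absurd h (not_lt.2 ih)

lemma append_lt_of_lt_of_not_isPrefix {a w : Vertex} (h : a < w) (hp : ¬ a <+: w)
    (c : Vertex) : a ++ c < w := by
  induction a generalizing w with
  | nil => exact absurd List.nil_prefix hp
  | cons x a ih =>
    cases w with
    | nil => exact absurd h (List.not_lt_nil _)
    | cons y w =>
      rw [List.cons_lt_cons_iff] at h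
      rw [List.cons_append, List.cons_lt_cons_iff]
      rcases h with h | ⟨rfl, h⟩
      · exact Or.inl h
      · exact Or.inr ⟨rfl, ih h fun h' => hp (by simpa using h')⟩

lemma finite_setOf_isPrefix (w : Vertex) : {x : Vertex | x <+: w}.Finite :=
  (List.finite_toSet w.inits).subset fun x hx => by simpa using hx

lemma ncard_setOf_proper_prefix (w : Vertex) : {x : Vertex | x <+: w ∧ x ≠ w}.ncard = w.length := by
  have : {x : Vertex | x <+: w ∧ x ≠ w} = (fun i => w.take i) '' (Finset.range w.length : Set ℕ) := by
    ext x
    simp only [mem_ofPred_eq, Finset.coe_range, mem_image, mem_Iio]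
    constructor
    · rintro ⟨h, hne⟩
      refine ⟨x.length, lt_of_le_of_ne h.length_le fun h' => hne (h.eq_of_length h'), ?_⟩
      exact (List.prefix_iff_eq_take.1 h).symm
    · rintro ⟨i, hi, rfl⟩
      refine ⟨List.take_prefix _ _, fun h => ?_⟩
      have := congrArg List.length h
      simp at this
      omega
  rw [this, Set.InjOn.ncard_image, Set.ncard_coe_finset, Finset.card_range]
  intro i hi j hj hij
  have := congrArg List.length hij
  simp at this hi hj
  omega

/-! ### Local agreement of trees -/

/-- `s` and `t` agree at `u`: both or neither contain `u`, and `u` has the same children. -/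
def AgreeAt (s t : Set Vertex) (u : Vertex) : Prop :=
  (u ∈ s ↔ u ∈ t) ∧ ∀ i : ℕ, u ++ [i] ∈ s ↔ u ++ [i] ∈ t

lemma mem_iff_lt_ncard {S : Set ℕ} (hS : S.Finite) (hl : ∀ i j, i ∈ S → j ≤ i → j ∈ S) (i : ℕ) :
    i ∈ S ↔ i < S.ncard := by
  constructor
  · intro hi
    have h : Set.Iic i ⊆ S := fun j hj => hl i j hi hj
    have := Set.ncard_le_ncard h hS
    rw [← Finset.coe_Iic, Set.ncard_coe_finset, Nat.card_Iic] at this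
    omega
  · intro hi
    by_contra hn
    have h : S ⊆ Set.Iio i := fun j hj => by
      by_contra h'
      exact hn (hl j i hj (not_lt.1 h'))
    have := Set.ncard_le_ncard h (Set.finite_Iio i)
    rw [← Finset.coe_Iio, Set.ncard_coe_finset, Nat.card_Iio] at this
    omega

lemma agreeAt_of_deg_eq {s t : Set Vertex} (hs : IsTree s) (ht : IsTree t) (hsf : LocFin s)
    (htf : LocFin t) {u : Vertex} (h : deg s u = deg t u) : AgreeAt s t u := by
  by_cases hus : u ∈ s <;> by_cases hut : u ∈ t
  · refine ⟨iff_of_true hus hut, fun i => ?_⟩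
    have hc : childCount s u = childCount t u := by simpa [deg, hus, hut] using h
    have e1 := mem_iff_lt_ncard (hsf u) (fun i j => hs.2.2 u i j) i
    have e2 := mem_iff_lt_ncard (htf u) (fun i j => ht.2.2 u i j) i
    unfold childCount at hc
    rw [hc] at e1
    exact e1.trans e2.symm
  · simp [deg, hus, hut] at h
  · simp [deg, hus, hut] at h
  · exact ⟨iff_of_false hus hut, fun i => iff_of_false (fun h' => hus (hs.2.1 _ _ h'))
      fun h' => hut (ht.2.1 _ _ h')⟩

lemma locFin_of_finite {s : Set Vertex} (hs : s.Finite) : LocFin s := fun u =>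
  hs.preimage (f := fun i : ℕ => u ++ [i]) fun i _ j _ h => by simpa using h

lemma LocalConv.eventually_agreeAt {ts : ℕ → Set Vertex} {t : Set Vertex}
    (hconv : LocalConv ts t) (hts : ∀ n, MemTf (ts n)) (ht : IsTree t) (htf : LocFin t)
    (u : Vertex) : ∀ᶠ n in atTop, AgreeAt (ts n) t u :=
  (hconv u).mono fun n h => agreeAt_of_deg_eq (hts n).1 ht (locFin_of_finite (hts n).2.1) htf h

lemma mem_iff_of_agreeAt {s t : Set Vertex} (hs : IsTree s) (ht : IsTree t) {P : Vertex → Prop}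
    (hP : ∀ u v, P (u ++ v) → P u) (h : ∀ u ∈ t, P u → AgreeAt s t u) (u : Vertex) (hu : P u) :
    u ∈ s ↔ u ∈ t := by
  refine ⟨fun hus => ?_, fun hut => (h u hut hu).1.2 hut⟩
  induction u using List.reverseRecOn with
  | nil => exact ht.1
  | append_singleton u i ih =>
    exact ((h u (ih (hP _ _ hu) (hs.2.1 _ _ hus)) (hP _ _ hu)).2 i).1 hus

lemma eventually_agree_of_finite {ts : ℕ → Set Vertex} {t : Set Vertex} (hts : ∀ n, IsTree (ts n))
    (ht : IsTree t) (hA : ∀ u, ∀ᶠ n in atTop, AgreeAt (ts n) t u) {P : Vertex → Prop}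
    (hP : ∀ u v, P (u ++ v) → P u) (hfin : {x ∈ t | P x}.Finite) :
    ∀ᶠ n in atTop, (∀ u ∈ t, P u → AgreeAt (ts n) t u) ∧ ∀ u, P u → (u ∈ ts n ↔ u ∈ t) := by
  have := (Filter.eventually_all_finite hfin).2 fun u _ => hA u
  filter_upwards [this] with n hn
  have h : ∀ u ∈ t, P u → AgreeAt (ts n) t u := fun u hu hPu => hn u ⟨hu, hPu⟩
  exact ⟨h, mem_iff_of_agreeAt (hts n) ht hP h⟩

lemma tendsto_encard_top {α : Type*} {A : Set α} {B : ℕ → Set α} (hA : A.Infinite)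
    (h : ∀ x ∈ A, ∀ᶠ n in atTop, x ∈ B n) :
    Tendsto (fun n => (B n).encard) atTop (𝓝 ⊤) := by
  rw [ENat.tendsto_nhds_top_iff_natCast_lt]
  intro m
  obtain ⟨F, hF, hc⟩ := hA.exists_subset_card_eq (m + 1)
  have := (Filter.eventually_all_finset F).2 fun u hu => h u (hF hu)
  filter_upwards [this] with n hn
  have h1 : (F : Set α) ⊆ B n := hn
  have h2 := Set.encard_le_encard h1
  rw [Set.encard_coe_eq_coe_finsetCard, hc] at h2
  exact lt_of_lt_of_le (by exact_mod_cast Nat.lt_succ_self m) h2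

/-! ### Enumerations -/

/-- `e` enumerates an initial part of `A` in the order given by `r`. -/
def EnumeratesBy {α : Type*} (r : α → α → Prop) (A : Set α) (e : ℕ → α) : Prop :=
  ∀ i : ℕ, (i : ℕ∞) < A.encard → e i ∈ A ∧ {x ∈ A | r x (e i)} = e '' {j | j < i}

lemma EnumeratesBy.rel {α : Type*} {r : α → α → Prop} {A : Set α} {e : ℕ → α}
    (he : EnumeratesBy r A e) {i j : ℕ} (hij : i < j) (hj : (j : ℕ∞) < A.encard) :
    r (e i) (e j) := by
  have : e i ∈ {x ∈ A | r x (e j)} := by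
    rw [(he j hj).2]
    exact ⟨i, hij, rfl⟩
  exact this.2

lemma EnumeratesBy.finite {α : Type*} {r : α → α → Prop} {A : Set α} {e : ℕ → α}
    (he : EnumeratesBy r A e) {i : ℕ} (hi : (i : ℕ∞) < A.encard) : {x ∈ A | r x (e i)}.Finite := by
  rw [(he i hi).2]
  exact (Set.finite_lt_nat i).image e

lemma EnumeratesBy.eq {α : Type*} {r : α → α → Prop} [IsStrictTotalOrder α r] {A B : Set α}
    {e f : ℕ → α} (he : EnumeratesBy r A e) (hf : EnumeratesBy r B f) {k : ℕ}
    (hA : (k : ℕ∞) < A.encard) (hB : (k : ℕ∞) < B.encard)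
    (h : ∀ x, (r x (f k) ∨ x = f k) → (x ∈ A ↔ x ∈ B)) : e k = f k := by
  induction k using Nat.strong_induction_on with
  | _ k ih =>
    have hlt : ∀ j < k, e j = f j := by
      intro j hj
      have hjk : (j : ℕ∞) < k := by exact_mod_cast hj
      refine ih j hj (hjk.trans hA) (hjk.trans hB) fun x hx => h x (Or.inl ?_)
      have hr := hf.rel hj hB
      rcases hx with hx | rfl
      · exact _root_.trans hx hr
      · exact hr
    have hpre : {x ∈ A | r x (e k)} = {x ∈ A | r x (f k)} := by
      have himg : e '' {j | j < k} = f '' {j | j < k} := Set.image_congr hlt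
      rw [(he k hA).2, himg, ← (hf k hB).2]
      ext x
      exact ⟨fun hx => ⟨(h x (Or.inl hx.2)).2 hx.1, hx.2⟩,
        fun hx => ⟨(h x (Or.inl hx.2)).1 hx.1, hx.2⟩⟩
    have heA := (he k hA).1
    have hfA := (h _ (Or.inr rfl)).2 (hf k hB).1
    rcases trichotomous_of r (e k) (f k) with hr | hr | hr
    · exact absurd ((hpre.symm.subset ⟨heA, hr⟩).2) (irrefl_of r _)
    · exact hr
    · exact absurd ((hpre.subset ⟨hfA, hr⟩).2) (irrefl_of r _)

/-! ### The map `Φ^{321}` depends locally on its data -/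

/-- `f` is strictly increasing on the indices below `L`. -/
def StrictMonoBelow (f : ℕ → ℕ) (L : ℕ∞) : Prop :=
  ∀ i j : ℕ, i < j → (j : ℕ∞) < L → f i < f j

lemma StrictMonoBelow.le {f : ℕ → ℕ} {L : ℕ∞} (hf : StrictMonoBelow f L) {i : ℕ}
    (hi : (i : ℕ∞) < L) : i ≤ f i := by
  induction i with
  | zero => exact Nat.zero_le _
  | succ i ih =>
    have h : (i : ℕ∞) < L := lt_trans (by exact_mod_cast Nat.lt_succ_self i) hi
    have := hf i (i + 1) (Nat.lt_succ_self i) hi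
    have := ih h
    omega

lemma StrictMonoBelow.exists_iff {f g : ℕ → ℕ} {L : ℕ∞} (hf : StrictMonoBelow f L)
    (hg : StrictMonoBelow g ⊤) {M : ℕ} (h : ∀ i < M, (i : ℕ∞) < L ∧ f i = g i) {b : ℕ}
    (hb : b < M) : (∃ i : ℕ, (i : ℕ∞) < L ∧ f i = b) ↔ ∃ i : ℕ, (i : ℕ∞) < ⊤ ∧ g i = b := by
  constructor
  · rintro ⟨i, hi, rfl⟩
    exact ⟨i, ENat.natCast_lt_top i, (h i ((hf.le hi).trans_lt hb)).2.symm⟩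
  · rintro ⟨i, hi, rfl⟩
    exact ⟨i, h i ((hg.le hi).trans_lt hb)⟩

lemma nthOf_congr {C D : Set ℕ} {a m : ℕ} (ha : a ≤ (D ∩ Set.Icc 1 m).ncard)
    (h : ∀ b ≤ m, b ∈ C ↔ b ∈ D) : nthOf C a = nthOf D a := by
  have key : ∀ j ≤ m, C ∩ Set.Icc 1 j = D ∩ Set.Icc 1 j := by
    intro j hj
    ext x
    simp only [mem_inter_iff, mem_Icc]
    exact and_congr_left fun hx => h x (hx.2.trans hj)
  have mono : ∀ E : Set ℕ, ∀ j, m ≤ j → (E ∩ Set.Icc 1 m).ncard ≤ (E ∩ Set.Icc 1 j).ncard :=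
    fun E j hj => Set.ncard_le_ncard
      (Set.inter_subset_inter_right _ (Set.Icc_subset_Icc_right hj))
      ((Set.finite_Icc 1 j).inter_of_right E)
  unfold nthOf
  congr 1
  ext j
  simp only [mem_ofPred_eq]
  rcases le_total j m with hj | hj
  · rw [key j hj]
  · exact iff_of_true ((key m le_rfl ▸ ha).trans (mono C j hj)) (ha.trans (mono D j hj))

lemma exists_le_ncard_inter_Icc {C : Set ℕ} (hC : C.Infinite) (a : ℕ) :
    ∃ m, a ≤ (C ∩ Set.Icc 1 m).ncard := by
  obtain ⟨F, hF, hc⟩ := (hC.sdiff (Set.finite_singleton 0)).exists_subset_card_eq a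
  refine ⟨F.sup id, ?_⟩
  rw [← hc, ← Set.ncard_coe_finset]
  refine Set.ncard_le_ncard (fun x hx => ⟨(hF hx).1, ?_, ?_⟩)
    ((Set.finite_Icc _ _).inter_of_right C)
  · exact Nat.one_le_iff_ne_zero.2 (hF hx).2
  · exact Finset.le_sup (f := id) hx

lemma exists_phi321Fun_eq {S P : ℕ → ℕ} (hS : StrictMonoBelow S ⊤)
    (hSP : StrictMonoBelow (fun i => S i - P i + 1) ⊤) (hA : (Aset S ⊤)ᶜ.Infinite) (k : ℕ) :
    ∃ M : ℕ, ∀ (S' P' : ℕ → ℕ) (L : ℕ∞), StrictMonoBelow S' L →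
      StrictMonoBelow (fun i => S' i - P' i + 1) L →
      (∀ i < M, (i : ℕ∞) < L ∧ S' i = S i ∧ P' i = P i) →
      phi321Fun S' P' L k = phi321Fun S P ⊤ k := by
  obtain ⟨m, hm⟩ := exists_le_ncard_inter_Icc hA (rankIn (Bset S P ⊤)ᶜ k)
  refine ⟨max (k + 1) (m + 1), fun S' P' L hS' hSP' h => ?_⟩
  have hB : ∀ b ≤ k, b ∈ Bset S' P' L ↔ b ∈ Bset S P ⊤ := fun b hb =>
    hSP'.exists_iff hSP (M := k + 1) (fun i hi => by
      obtain ⟨h0, h1, h2⟩ := h i (lt_max_of_lt_left hi)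
      exact ⟨h0, by simp only [h1, h2]⟩) (by omega)
  have hA' : ∀ b ≤ m, b ∈ Aset S' L ↔ b ∈ Aset S ⊤ := fun b hb =>
    hS'.exists_iff hS (M := m + 1) (fun i hi => by
      obtain ⟨h0, h1, -⟩ := h i (lt_max_of_lt_right hi)
      exact ⟨h0, h1⟩) (by omega)
  have hrank : rankIn (Bset S' P' L)ᶜ k = rankIn (Bset S P ⊤)ᶜ k := by
    unfold rankIn
    congr 1
    ext x
    simp only [mem_inter_iff, mem_compl_iff, mem_Icc]
    exact and_congr_left fun hx => not_congr (hB x hx.2)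
  by_cases hk : k ∈ Bset S P ⊤
  · have hk' := (hB k le_rfl).2 hk
    rw [phi321Fun, phi321Fun, dif_pos hk, dif_pos hk']
    obtain ⟨-, e⟩ := hk.choose_spec
    obtain ⟨hi', e'⟩ := hk'.choose_spec
    generalize hk.choose = i at *
    generalize hk'.choose = i' at *
    have hik : i' < k + 1 := Nat.lt_succ_of_le (by simpa only [e'] using hSP'.le hi')
    obtain ⟨-, h1, h2⟩ := h i' (lt_max_of_lt_left hik)
    rw [h1, h2] at e'
    rw [h1]
    rcases lt_trichotomy i i' with hlt | rfl | hlt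
    · have := hSP _ _ hlt (ENat.natCast_lt_top _)
      simp only [e, e', lt_irrefl] at this
    · rfl
    · have := hSP _ _ hlt (ENat.natCast_lt_top _)
      simp only [e, e', lt_irrefl] at this
  · have hk' := fun h' => hk ((hB k le_rfl).1 h')
    rw [phi321Fun, phi321Fun, dif_neg hk, dif_neg hk', hrank]
    rw [nthOf_congr (C := (Aset S' L)ᶜ) hm fun b hb => not_congr (hA' b hb)]

/-! ### The spine -/

lemma exists_isSpine_of_infinite {D : Set Vertex} (hD : ∀ u v : Vertex, u ++ v ∈ D → u ∈ D)
    (hlf : LocFin D) (hinf : D.Infinite) : ∃ η, IsSpine D η := by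
  have step : ∀ u : Vertex, (fringe D u).Infinite → ∃ c : ℕ, (fringe D (u ++ [c])).Infinite := by
    intro u hu
    by_contra! hn
    refine hu (((Set.finite_singleton u).union
      ((hlf u).biUnion fun c _ => hn c)).subset ?_)
    rintro x ⟨hx, v, rfl⟩
    cases v with
    | nil => exact Or.inl (by simp)
    | cons c v =>
      refine Or.inr (Set.mem_biUnion (x := c) (hD (u ++ [c]) v (by simpa using hx)) ⟨hx, v, by simp⟩)
  choose g hg using step
  have h0 : (fringe D []).Infinite := by simpa [fringe] using hinf
  let f : ℕ → {u : Vertex // (fringe D u).Infinite} := fun n =>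
    Nat.rec ⟨[], h0⟩ (fun _ u => ⟨u.1 ++ [g u.1 u.2], hg u.1 u.2⟩) n
  refine ⟨fun n => (f n).1, rfl, fun i => ?_, fun i => ⟨_, rfl⟩⟩
  obtain ⟨x, hx, v, rfl⟩ := (f i).2.nonempty
  exact hD _ v hx

lemma IsSpine.length {t : Set Vertex} {η : ℕ → Vertex} (h : IsSpine t η) (i : ℕ) :
    (η i).length = i := by
  induction i with
  | zero => simp [h.1]
  | succ i ih =>
    obtain ⟨c, hc⟩ := h.2.2 i
    simp [hc, ih]

lemma IsSpine.isPrefix {t : Set Vertex} {η : ℕ → Vertex} (h : IsSpine t η) {i j : ℕ}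
    (hij : i ≤ j) : η i <+: η j := by
  induction j, hij using Nat.le_induction with
  | base => exact List.prefix_rfl
  | succ j _ ih =>
    obtain ⟨c, hc⟩ := h.2.2 j
    exact ih.trans (hc ▸ List.prefix_append _ _)

lemma IsSpine.eq_of_isPrefix {t : Set Vertex} {η : ℕ → Vertex} (h : IsSpine t η) {u : Vertex}
    {i : ℕ} (hu : u <+: η i) : η u.length = u := by
  have hl : u.length ≤ i := by simpa [h.length] using hu.length_le
  exact (List.prefix_of_prefix_length_le (h.isPrefix hl) hu (by simp [h.length])).eq_of_length
    (h.length _)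

lemma IsSpine.lt {t : Set Vertex} {η : ℕ → Vertex} (h : IsSpine t η) {i j : ℕ} (hij : i < j) :
    η i < η j :=
  lt_of_le_of_ne (le_of_isPrefix (h.isPrefix hij.le)) fun he => by
    have := congrArg List.length he
    rw [h.length, h.length] at this
    omega

/-- By König's lemma, a vertex of the unique spine has finitely many predecessors. -/
lemma finite_lt_spine {t : Set Vertex} {η : ℕ → Vertex} (ht : IsTree t) (htf : LocFin t)
    (hη : IsSpine t η) (huniq : ∀ η', IsSpine t η' → η' = η) (j : ℕ) :
    {x ∈ t | x < η j}.Finite := by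
  by_contra hinf
  obtain ⟨η', h'⟩ := exists_isSpine_of_infinite (D := {x ∈ t | x < η j})
    (fun u v huv => ⟨ht.2.1 u v huv.1, (le_of_isPrefix (List.prefix_append u v)).trans_lt huv.2⟩)
    (fun u => (htf u).subset fun i hi => hi.1) hinf
  have := huniq η' ⟨h'.1, fun i => (h'.2.1 i).1, h'.2.2⟩
  subst this
  exact lt_irrefl _ (h'.2.1 j).2

lemma LeftOfSpine.not_isPrefix {t : Set Vertex} {η : ℕ → Vertex} (hη : IsSpine t η) {u : Vertex}
    (hu : LeftOfSpine t η u) (i : ℕ) : ¬ u <+: η i := fun h => hu.2.1 _ (hη.eq_of_isPrefix h)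

lemma exists_leftLeaf {t : Set Vertex} {η : ℕ → Vertex} (hη : IsSpine t η)
    (hfin : ∀ j, {x ∈ t | x < η j}.Finite) {u : Vertex} (hu : LeftOfSpine t η u) :
    ∃ x ∈ leftLeaves t η, u <+: x := by
  obtain ⟨j, hj⟩ := hu.2.2
  have hlt : ∀ v, u ++ v < η j := append_lt_of_lt_of_not_isPrefix hj (hu.not_isPrefix hη j)
  have hf : (fringe t u).Finite := (hfin j).subset fun x hx => by
    obtain ⟨hx, v, rfl⟩ := hx
    exact ⟨hx, hlt v⟩
  obtain ⟨m, ⟨hm, v, rfl⟩, hmax⟩ := Set.exists_max_image _ id hf ⟨u, hu.1, List.prefix_rfl⟩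
  refine ⟨u ++ v, ⟨⟨hm, fun i hi => ?_⟩, hm, fun i hi => ?_, j, hlt v⟩, List.prefix_append _ _⟩
  · have h1 := hmax _ ⟨hi, (List.prefix_append _ _).trans (List.prefix_append _ _)⟩
    have h2 := le_of_isPrefix (List.prefix_append (u ++ v) [i])
    have := le_antisymm h1 h2
    simp at this
  · exact hu.not_isPrefix hη i (hi ▸ List.prefix_append _ _)

lemma infinite_leftLeaves {t : Set Vertex} {η : ℕ → Vertex} (hη : IsSpine t η)
    (hfin : ∀ j, {x ∈ t | x < η j}.Finite) (hinf : {u | LeftOfSpine t η u}.Infinite) :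
    (leftLeaves t η).Infinite := fun h => hinf <|
  (h.biUnion fun x _ => finite_setOf_isPrefix x).subset fun u hu => by
    obtain ⟨x, hx, hux⟩ := exists_leftLeaf hη hfin hu
    exact Set.mem_biUnion hx hux

/-! ### Ranks and heights of leaves -/

lemma ncard_lt_of_lt {t : Set Vertex} {x y : Vertex} (hx : x ∈ t) (hxy : x < y)
    (hy : {z ∈ t | z < y}.Finite) : {z ∈ t | z < x}.ncard < {z ∈ t | z < y}.ncard :=
  Set.ncard_lt_ncard (Set.ssubset_iff_of_subset
    (fun _ hz => And.intro hz.1 (hz.2.trans hxy)) |>.2 ⟨x, ⟨hx, hxy⟩, fun h => lt_irrefl _ h.2⟩) hy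

lemma ncard_sub_length {t : Set Vertex} (ht : IsTree t) {x : Vertex} (hx : x ∈ t)
    (hfin : {z ∈ t | z < x}.Finite) :
    {z ∈ t | z < x}.ncard - x.length = {z ∈ t | z < x ∧ ¬ z <+: x}.ncard := by
  have hu : {z ∈ t | z < x} = {z ∈ t | z < x ∧ ¬ z <+: x} ∪ {z | z <+: x ∧ z ≠ x} := by
    ext z
    simp only [mem_union, mem_ofPred_eq]
    constructor
    · rintro ⟨hz, hzx⟩
      by_cases hp : z <+: x
      · exact Or.inr ⟨hp, hzx.ne⟩
      · exact Or.inl ⟨hz, hzx, hp⟩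
    · rintro (⟨hz, hzx, -⟩ | ⟨hp, hne⟩)
      · exact ⟨hz, hzx⟩
      · refine ⟨?_, lt_of_le_of_ne (le_of_isPrefix hp) hne⟩
        obtain ⟨v, rfl⟩ := hp
        exact ht.2.1 _ _ hx
  have hd : Disjoint {z ∈ t | z < x ∧ ¬ z <+: x} {z | z <+: x ∧ z ≠ x} :=
    Set.disjoint_left.2 fun z hz hz' => hz.2.2 hz'.1
  rw [hu] at hfin
  rw [hu, Set.ncard_union_eq hd (hfin.subset subset_union_left) (hfin.subset subset_union_right),
    ncard_setOf_proper_prefix, Nat.add_sub_cancel]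

lemma IsLeaf.ncard_sub_length_lt {t : Set Vertex} (ht : IsTree t) {x y : Vertex} (hx : IsLeaf t x)
    (hy : y ∈ t) (hxy : x < y) (hfin : {z ∈ t | z < y}.Finite) :
    {z ∈ t | z < x}.ncard - x.length < {z ∈ t | z < y}.ncard - y.length := by
  rw [ncard_sub_length ht hx.1 (hfin.subset fun _ hz => ⟨hz.1, hz.2.trans hxy⟩),
    ncard_sub_length ht hy hfin]
  refine Set.ncard_lt_ncard (Set.ssubset_iff_of_subset ?_ |>.2
    ⟨x, ⟨hx.1, hxy, ?_⟩, fun h => lt_irrefl _ h.2.1⟩) (hfin.subset fun _ hz => ⟨hz.1, hz.2.1⟩)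
  · rintro z ⟨hz, hzx, hp⟩
    refine ⟨hz, hzx.trans hxy, ?_⟩
    rintro ⟨v, rfl⟩
    exact lt_asymm hxy (append_lt_of_lt_of_not_isPrefix hzx hp v)
  · rintro ⟨v, rfl⟩
    cases v with
    | nil => simp at hxy
    | cons c v => exact hx.2 c (ht.2.1 (x ++ [c]) v (by simpa using hy))

lemma strictMonoBelow_sVal {t A : Set Vertex} (hAt : ∀ x ∈ A, IsLeaf t x)
    (hfin : ∀ x ∈ A, {z ∈ t | z < x}.Finite) {l : ℕ → Vertex}
    (hl : EnumeratesBy (· < ·) A l) : StrictMonoBelow (sVal t l) A.encard := fun i j hij hj =>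
  ncard_lt_of_lt (hAt _ (hl i (lt_trans (by exact_mod_cast hij) hj)).1).1 (hl.rel hij hj)
    (hfin _ (hl j hj).1)

lemma strictMonoBelow_sVal_sub_pVal {t A : Set Vertex} (ht : IsTree t)
    (hAt : ∀ x ∈ A, IsLeaf t x) (hfin : ∀ x ∈ A, {z ∈ t | z < x}.Finite) {l : ℕ → Vertex}
    (hl : EnumeratesBy (· < ·) A l) :
    StrictMonoBelow (fun i => sVal t l i - pVal l i + 1) A.encard := fun i j hij hj =>
  Nat.succ_lt_succ <| (hAt _ (hl i (lt_trans (by exact_mod_cast hij) hj)).1).ncard_sub_length_lt ht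
    (hAt _ (hl j hj).1).1 (hl.rel hij hj) (hfin _ (hl j hj).1)

lemma infinite_compl_Aset {t : Set Vertex} {η : ℕ → Vertex} (hη : IsSpine t η)
    (hfin : ∀ j, {x ∈ t | x < η j}.Finite) {l : ℕ → Vertex}
    (hl : ∀ i, LeftOfSpine t η (l i)) : (Aset (sVal t l) ⊤)ᶜ.Infinite := by
  have hmono : StrictMono fun j => {x ∈ t | x < η j}.ncard := fun i j hij =>
    ncard_lt_of_lt (hη.2.1 i) (hη.lt hij) (hfin j)
  refine (Set.infinite_range_of_injective hmono.injective).mono ?_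
  rintro _ ⟨j, rfl⟩ ⟨i, -, hi⟩
  obtain ⟨m, hm⟩ := (hl i).2.2
  rcases lt_trichotomy (l i) (η j) with h | h | h
  · exact (ncard_lt_of_lt (hl i).1 h (hfin j)).ne hi
  · exact (hl i).2.1 j h.symm
  · exact (ncard_lt_of_lt (hη.2.1 j) h
      ((hfin m).subset fun _ hz => ⟨hz.1, hz.2.trans hm⟩)).ne' hi

/-! ### Convergence of the ingredients of the maps `Φ` -/

lemma tendsto_encard_sep {ts : ℕ → Set Vertex} {t : Set Vertex} (hts : ∀ n, IsTree (ts n))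
    (ht : IsTree t) (hA : ∀ u, ∀ᶠ n in atTop, AgreeAt (ts n) t u) {P Q : Vertex → Prop}
    (hP : ∀ u v, P (u ++ v) → P u) (hQP : ∀ x, Q x → P x)
    (hfin : {x ∈ t | Q x}.Finite → {x ∈ t | P x}.Finite) :
    Tendsto (fun n => {x ∈ ts n | Q x}.encard) atTop (𝓝 {x ∈ t | Q x}.encard) := by
  by_cases hf : {x ∈ t | Q x}.Finite
  · refine tendsto_nhds_of_eventually_eq ?_
    filter_upwards [eventually_agree_of_finite hts ht hA hP (hfin hf)] with n hn
    congr 1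
    ext x
    exact and_congr_left fun hx => hn.2 x (hQP x hx)
  · rw [Set.encard_eq_top hf]
    exact tendsto_encard_top hf fun x hx => (hA x).mono fun n hn => ⟨hn.1.2 hx.1, hx.2⟩

lemma tendsto_encard_fringe {ts : ℕ → Set Vertex} {t : Set Vertex} (hts : ∀ n, IsTree (ts n))
    (ht : IsTree t) (hA : ∀ u, ∀ᶠ n in atTop, AgreeAt (ts n) t u) (u : Vertex) :
    Tendsto (fun n => (fringe (ts n) u).encard) atTop (𝓝 (fringe t u).encard) := by
  refine tendsto_encard_sep hts ht hA (P := fun x => x <+: u ∨ u <+: x) ?_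
    (fun x hx => Or.inr hx) fun hf => ?_
  · rintro a b (h | h)
    · exact Or.inl ((List.prefix_append a b).trans h)
    · exact List.prefix_or_prefix_of_prefix (List.prefix_append a b) h
  · refine ((finite_setOf_isPrefix u).union hf).subset ?_
    rintro x ⟨hx, h | h⟩
    · exact Or.inl h
    · exact Or.inr ⟨hx, h⟩

lemma tendsto_encard_diff_fringe {ts : ℕ → Set Vertex} {t : Set Vertex}
    (hts : ∀ n, IsTree (ts n)) (ht : IsTree t) (hA : ∀ u, ∀ᶠ n in atTop, AgreeAt (ts n) t u)
    (u : Vertex) :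
    Tendsto (fun n => (ts n \ fringe (ts n) u).encard) atTop (𝓝 (t \ fringe t u).encard) := by
  have h : ∀ s : Set Vertex, s \ fringe s u = {x ∈ s | ¬ u <+: x} := fun s => by
    ext x
    simp only [fringe, Set.mem_sdiff, mem_ofPred_eq]
    tauto
  simp only [h]
  exact tendsto_encard_sep hts ht hA (P := fun x => ¬ u <+: x)
    (fun a b h h' => h (h'.trans (List.prefix_append a b))) (fun _ => id) id

lemma finite_le_of_finite_lt {t : Set Vertex} {y : Vertex} (h : {x ∈ t | x < y}.Finite) :
    {x ∈ t | x ≤ y}.Finite := (h.insert y).subset fun _ hx =>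
  hx.2.eq_or_lt.imp id fun h => ⟨hx.1, h⟩

lemma le_of_append_le {y : Vertex} (u v : Vertex) (h : u ++ v ≤ y) : u ≤ y :=
  (le_of_isPrefix (List.prefix_append u v)).trans h

lemma eventually_lt_encard {α : Type*} {A : Set α} {B : ℕ → Set α} (hA : A.Infinite)
    (h : ∀ x ∈ A, ∀ᶠ n in atTop, x ∈ B n) (k : ℕ) : ∀ᶠ n in atTop, (k : ℕ∞) < (B n).encard :=
  ENat.tendsto_nhds_top_iff_natCast_lt.1 (tendsto_encard_top hA h) k

lemma eventually_lexEnum_eq {ts : ℕ → Set Vertex} {t : Set Vertex} (hts : ∀ n, IsTree (ts n))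
    (ht : IsTree t) (hinf : t.Infinite) (hA : ∀ u, ∀ᶠ n in atTop, AgreeAt (ts n) t u)
    {vs : ℕ → ℕ → Vertex} {v : ℕ → Vertex} (hvs : ∀ n, IsLexEnum (ts n) (vs n))
    (hv : IsLexEnum t v) (k : ℕ) : ∀ᶠ n in atTop, vs n k = v k := by
  have hk : (k : ℕ∞) < t.encard := by rw [hinf.encard_eq]; exact ENat.natCast_lt_top k
  have hv' : EnumeratesBy (· < ·) t v := hv
  filter_upwards [eventually_agree_of_finite hts ht hA (P := (· ≤ v k)) le_of_append_le
      (finite_le_of_finite_lt (hv'.finite hk)),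
    eventually_lt_encard hinf (fun x hx => (hA x).mono fun n hn => hn.1.2 hx) k] with n hn hkn
  exact EnumeratesBy.eq (r := (· < ·)) (hvs n) hv' hkn hk fun x hx => hn.2 x (le_of_lt_or_eq hx)

lemma eventually_lexCoEnum_eq {ts : ℕ → Set Vertex} {t : Set Vertex} (hts : ∀ n, IsTree (ts n))
    (ht : IsTree t) (hinf : t.Infinite) (hA : ∀ u, ∀ᶠ n in atTop, AgreeAt (ts n) t u)
    {ws : ℕ → ℕ → Vertex} {w : ℕ → Vertex} (hws : ∀ n, IsLexCoEnum (ts n) (ws n))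
    (hw : IsLexCoEnum t w) (k : ℕ) : ∀ᶠ n in atTop, ws n k = w k := by
  have hk : (k : ℕ∞) < t.encard := by rw [hinf.encard_eq]; exact ENat.natCast_lt_top k
  have hw' : EnumeratesBy (· > ·) t w := hw
  have hP : ∀ u v, (w k < u ++ v ∨ u ++ v <+: w k) → w k < u ∨ u <+: w k := by
    rintro u v (h | h)
    · rcases lt_trichotomy u (w k) with h' | rfl | h'
      · refine Or.inr (by_contra fun hp => lt_asymm h ?_)
        exact append_lt_of_lt_of_not_isPrefix h' hp v
      · exact Or.inr List.prefix_rfl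
      · exact Or.inl h'
    · exact Or.inr ((List.prefix_append u v).trans h)
  have hfin : {x ∈ t | w k < x ∨ x <+: w k}.Finite :=
    ((hw'.finite hk).union (finite_setOf_isPrefix (w k))).subset fun x hx =>
      hx.2.imp (fun h => ⟨hx.1, h⟩) id
  filter_upwards [eventually_agree_of_finite hts ht hA hP hfin,
    eventually_lt_encard hinf (fun x hx => (hA x).mono fun n hn => hn.1.2 hx) k] with n hn hkn
  exact EnumeratesBy.eq (r := (· > ·)) (hws n) hw' hkn hk fun x hx =>
    hn.2 x (hx.imp id fun h => by rw [h])

lemma leafSet_iff_leftLeaves {s t : Set Vertex} {η : ℕ → Vertex} (hη : IsSpine t η)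
    {x y : Vertex} (hy : LeftOfSpine t η y) (hxy : x ≤ y) (hmem : x ∈ s ↔ x ∈ t)
    (hagree : x ∈ t → AgreeAt s t x) : x ∈ leafSet s ↔ x ∈ leftLeaves t η := by
  constructor
  · rintro ⟨hxs, hleaf⟩
    have hxt := hmem.1 hxs
    have hl : ∀ i, x ++ [i] ∉ t := fun i h => hleaf i (((hagree hxt).2 i).2 h)
    obtain ⟨j, hj⟩ := hy.2.2
    refine ⟨⟨hxt, hl⟩, hxt, ?_, j, hxy.trans_lt hj⟩
    rintro i rfl
    obtain ⟨c, hc⟩ := hη.2.2 i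
    exact hl c (hc ▸ hη.2.1 (i + 1))
  · rintro ⟨⟨hxt, hleaf⟩, -⟩
    exact ⟨hmem.2 hxt, fun i h => hleaf i (((hagree hxt).2 i).1 h)⟩

lemma eventually_phi321Fun_eq {ts : ℕ → Set Vertex} (hts : ∀ n, MemTf (ts n))
    {t : Set Vertex} {η : ℕ → Vertex} (ht : IsTree t) (htf : LocFin t) (hη : SpineSpec t η)
    (hA : ∀ u, ∀ᶠ n in atTop, AgreeAt (ts n) t u) {ls : ℕ → ℕ → Vertex}
    (hls : ∀ n, IsEnumOf (leafSet (ts n)) (ls n)) {l : ℕ → Vertex}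
    (hl : IsEnumOf (leftLeaves t η) l) (k : ℕ) :
    ∀ᶠ n in atTop, phi321Fun (sVal (ts n) (ls n)) (pVal (ls n)) (leafSet (ts n)).encard k =
      phi321Fun (sVal t l) (pVal l) (leftLeaves t η).encard k := by
  have hl' : EnumeratesBy (· < ·) (leftLeaves t η) l := hl
  have hspine := finite_lt_spine ht htf hη.1 hη.2.1
  have hfin : ∀ x ∈ leftLeaves t η, {z ∈ t | z < x}.Finite := fun x hx => by
    obtain ⟨j, hj⟩ := hx.2.2.2
    exact (hspine j).subset fun z hz => ⟨hz.1, hz.2.trans hj⟩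
  have hinf : (leftLeaves t η).Infinite :=
    infinite_leftLeaves hη.1 hspine (hη.2.2.1.mono fun u hu => hu.2)
  have hlt : ∀ i : ℕ, (i : ℕ∞) < (leftLeaves t η).encard := fun i => by
    rw [hinf.encard_eq]; exact ENat.natCast_lt_top i
  have hS := strictMonoBelow_sVal (fun x hx => hx.1) hfin hl'
  have hSP := strictMonoBelow_sVal_sub_pVal ht (fun x hx => hx.1) hfin hl'
  rw [hinf.encard_eq] at hS hSP ⊢
  obtain ⟨M, hM⟩ := exists_phi321Fun_eq hS hSP
    (infinite_compl_Aset hη.1 hspine fun i => (hl' i (hlt i)).1.2) k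
  have hev : ∀ᶠ n in atTop, ∀ i ∈ Set.Iio M, (i : ℕ∞) < (leafSet (ts n)).encard ∧
      sVal (ts n) (ls n) i = sVal t l i ∧ pVal (ls n) i = pVal l i := by
    refine (Filter.eventually_all_finite (Set.finite_Iio M)).2 fun i _ => ?_
    have hli := (hl' i (hlt i)).1
    filter_upwards [eventually_agree_of_finite (fun n => (hts n).1) ht hA (P := (· ≤ l i))
        le_of_append_le (finite_le_of_finite_lt (hfin _ hli)),
      eventually_lt_encard (B := fun n => leafSet (ts n)) hinf (fun x hx => (hA x).mono
        fun n hn => (leafSet_iff_leftLeaves hη.1 hx.2 le_rfl hn.1 fun _ => hn).2 hx) i]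
      with n hn hin
    have he : ls n i = l i := EnumeratesBy.eq (r := (· < ·)) (hls n) hl' hin (hlt i) fun x hx =>
      leafSet_iff_leftLeaves hη.1 hli.2 (le_of_lt_or_eq hx) (hn.2 x (le_of_lt_or_eq hx))
        fun hxt => hn.1 x hxt (le_of_lt_or_eq hx)
    refine ⟨hin, ?_, by rw [pVal, pVal, he]⟩
    rw [sVal, sVal, he]
    congr 1
    ext x
    exact and_congr_left fun hx => hn.2 x hx.le
  filter_upwards [hev] with n hn
  have hfn : ∀ x ∈ leafSet (ts n), {z ∈ ts n | z < x}.Finite := fun x _ =>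
    (hts n).2.1.subset fun z hz => hz.1
  exact hM _ _ _ (strictMonoBelow_sVal (fun x hx => hx) hfn (hls n))
    (strictMonoBelow_sVal_sub_pVal (hts n).1 (fun x hx => hx) hfn (hls n)) hn

lemma exists_phi321Fun_eq_natCast (S P : ℕ → ℕ) (L : ℕ∞) (k : ℕ) :
    ∃ m : ℕ, phi321Fun S P L k = m := by
  unfold phi321Fun
  split_ifs
  · exact ⟨_, rfl⟩
  · exact ⟨_, rfl⟩

lemma tendsto_ite_of_eventually_iff {c : ℕ → Prop} {p : Prop} [DecidablePred c] [Decidable p]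
    (hc : ∀ᶠ n in atTop, (c n ↔ p)) {f : ℕ → ℕ∞} {a b : ℕ∞} (hf : Tendsto f atTop (𝓝 a)) :
    Tendsto (fun n => if c n then f n else b) atTop (𝓝 (if p then a else b)) := by
  by_cases hp : p
  · rw [if_pos hp]
    exact hf.congr' (hc.mono fun n hn => (if_pos (hn.2 hp)).symm)
  · rw [if_neg hp]
    exact tendsto_nhds_of_eventually_eq (hc.mono fun n hn => if_neg (mt hn.1 hp))

/-- Theorem `thm deterministic`.  Fix `σ ∈ S_3`.  If `t_n ∈ 𝔗_f`,
`t ∈ 𝔗_∞` and `t_n → t` locally, then for each `k ∈ ℕ`, `Φ^σ_{t_n}(k) → Φ^σ_t(k)`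
in `ℕ* = ℕ ∪ {∞}`. -/
theorem phi_continuous (σ : Equiv.Perm (Fin 3))
    (ts : ℕ → Set Vertex) (hts : ∀ n, MemTf (ts n))
    (t : Set Vertex) (η : ℕ → Vertex)
    (h1 : IsTree t) (h2 : LocFin t) (h3 : t.Infinite) (h4 : SpineSpec t η)
    (hconv : LocalConv ts t)
    (vs ws ls : ℕ → ℕ → Vertex)
    (hvs : ∀ n, IsLexEnum (ts n) (vs n))
    (hws : ∀ n, IsLexCoEnum (ts n) (ws n))
    (hls : ∀ n, IsEnumOf (leafSet (ts n)) (ls n))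
    (v w l : ℕ → Vertex)
    (hv : IsLexEnum t v) (hw : IsLexCoEnum t w) (hl : IsEnumOf (leftLeaves t η) l)
    (k : ℕ) :
    Tendsto (fun n => PhiOf σ (ts n) (vs n) (ws n) (ls n) (leafSet (ts n)) k)
      atTop (𝓝 (PhiOf σ t v w l (leftLeaves t η) k)) := by
  have hA := hconv.eventually_agreeAt hts h1 h2
  have htree : ∀ n, IsTree (ts n) := fun n => (hts n).1
  have hcard : Tendsto (fun n => (ts n).encard) atTop (𝓝 t.encard) := by
    rw [h3.encard_eq]
    exact tendsto_encard_top h3 fun x hx => (hA x).mono fun n hn => hn.1.2 hx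
  have hcond : ∀ᶠ n in atTop, (1 ≤ k ∧ (k : ℕ∞) < (ts n).encard ↔ 1 ≤ k ∧ (k : ℕ∞) < t.encard) := by
    filter_upwards [eventually_lt_encard h3
      (fun x hx => (hA x).mono fun n hn => hn.1.2 hx) k] with n hn
    have : (k : ℕ∞) < t.encard := by rw [h3.encard_eq]; exact ENat.natCast_lt_top k
    simp only [hn, this]
  have hv' := eventually_lexEnum_eq htree h1 h3 hA hvs hv k
  have hw' := eventually_lexCoEnum_eq htree h1 h3 hA hws hw (k - 1)
  have h321 := eventually_phi321Fun_eq hts h1 h2 h4 hA hls hl k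
  have hfv := (tendsto_encard_fringe htree h1 hA (v k)).congr'
    (hv'.mono fun n he => congrArg (fun u => (fringe (ts n) u).encard) he.symm)
  have hdv := (tendsto_encard_diff_fringe htree h1 hA (v k)).congr'
    (hv'.mono fun n he => congrArg (fun u => (ts n \ fringe (ts n) u).encard) he.symm)
  have hfw := (tendsto_encard_fringe htree h1 hA (w (k - 1))).congr'
    (hw'.mono fun n he => congrArg (fun u => (fringe (ts n) u).encard) he.symm)
  have hlv : Tendsto (fun n => ((vs n k).length : ℕ∞)) atTop (𝓝 (v k).length) :=
    tendsto_nhds_of_eventually_eq (hv'.mono fun n he => by rw [he])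
  have hlw : Tendsto (fun n => ((ws n (k - 1)).length : ℕ∞)) atTop (𝓝 (w (k - 1)).length) :=
    tendsto_nhds_of_eventually_eq (hw'.mono fun n he => by rw [he])
  have hk : Tendsto (fun _ : ℕ => (k : ℕ∞)) atTop (𝓝 k) := tendsto_const_nhds
  have hnat : ∀ m : ℕ, (m : ℕ∞) ≠ ⊤ := ENat.natCast_ne_top
  unfold PhiOf
  split_ifs
  · exact tendsto_ite_of_eventually_iff hcond ((hk.add hfv).enatSub hlv (Or.inr (hnat _)))
  · exact tendsto_ite_of_eventually_iff hcond ((hdv.add hlv).enatSub hk (Or.inr (hnat _)))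
  · refine tendsto_ite_of_eventually_iff hcond ((hk.add hlw).enatSub hfw (Or.inl ?_))
    exact_mod_cast hnat (k + (w (k - 1)).length)
  · exact tendsto_ite_of_eventually_iff hcond
      (((hcard.add hfw).enatSub hk (Or.inr (hnat _))).enatSub hlw (Or.inr (hnat _)))
  · exact tendsto_nhds_of_eventually_eq h321
  · obtain ⟨m, hm⟩ := exists_phi321Fun_eq_natCast (sVal t l) (pVal l) (leftLeaves t η).encard k
    refine tendsto_ite_of_eventually_iff hcond ((hcard.add tendsto_const_nhds).enatSub
      (tendsto_nhds_of_eventually_eq h321) (Or.inr ?_))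
    rw [hm]
    exact hnat m

end AvoidPaper
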